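/- Let M = (a b; c d) be a 2×2 integer matrix with ad − bc = 1, and let q, p ∈ ℤ with q ≡ ab (mod 2) and p ≡ cd (mod 2). Then there exists μ ∈ ℂ with μ⁸ = 1 such that the Dirac comb is an eigenfunction of the shifted metaplectic operator: for every Schwartz function f : ℝ → ℂ, ⟨S_{(q/2,p/2)}𝓜(M)Ш₁, f⟩ = μ·∑_{n∈ℤ} f(n). -/

import Mathlib

open MeasureTheory

/-- The metaplectic operator `𝓜(M)` associated with a real matrix `M = (a b; c d)` with
`ad - bc = 1`, acting on functions `f : ℝ → ℂ`.  Square roots with positive real part are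
given by the principal complex power. -/
noncomputable def metaplectic (a b c d : ℝ) (f : ℝ → ℂ) (x : ℝ) : ℂ :=
  if b ≠ 0 then
    (Complex.I * (b : ℂ)) ^ (-(1/2) : ℂ) *
      ∫ y : ℝ, Complex.exp ((Real.pi : ℂ) * Complex.I / (b : ℂ) *
        ((d * x ^ 2 - 2 * x * y + a * y ^ 2 : ℝ) : ℂ)) * f y
  else if 0 < a then
    (a : ℂ) ^ (-(1/2) : ℂ) * Complex.exp ((Real.pi : ℂ) * Complex.I * ((c / a : ℝ) : ℂ)
      * ((x : ℂ)) ^ 2) * f (x / a)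
  else
    -Complex.I * ((-a : ℝ) : ℂ) ^ (-(1/2) : ℂ) *
      Complex.exp ((Real.pi : ℂ) * Complex.I * ((c / a : ℝ) : ℂ) * ((x : ℂ)) ^ 2) * f (x / a)

/-- The pairing `⟨S_{(q/2,p/2)} 𝓜(M) Ш₁, f⟩ = ∑_{n ∈ ℤ} (𝓜(M') g)(n)` where
`M' = (d b; c a)` and `g(x) = exp(πiqp/4 + πipx) f(x + q/2)`. -/
noncomputable def shiftMetaPair (a b c d q p : ℝ) (f : ℝ → ℂ) : ℂ :=
  ∑' n : ℤ, metaplectic d b c a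
    (fun x => Complex.exp ((Real.pi : ℂ) * Complex.I * (q : ℂ) * (p : ℂ) / 4
        + (Real.pi : ℂ) * Complex.I * (p : ℂ) * (x : ℂ)) * f (x + q / 2)) (n : ℝ)

open scoped SchwartzMap FourierTransform

/-- The quadratic Gauss sum `∑ ψ(A x² + s x)` over `ZMod (2N)`. -/
noncomputable def quadGaussSum (N : ℕ) [NeZero N] (A s : ZMod (2 * N)) : ℂ :=
  ∑ x : ZMod (2 * N), ZMod.stdAddChar (A * x ^ 2 + s * x)

lemma ZMod.eq_zero_or_eq_of_two_mul_eq_zero {N : ℕ} [NeZero N] {t : ZMod (2 * N)}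
    (h : 2 * t = 0) : t = 0 ∨ t = (N : ZMod (2 * N)) := by
  have hlt := ZMod.val_lt t
  have h1 : ((2 * t.val : ℕ) : ZMod (2 * N)) = 0 := by
    push_cast
    rw [ZMod.natCast_zmod_val, h]
  rw [ZMod.natCast_eq_zero_iff] at h1
  obtain ⟨k, hk⟩ := h1
  have hk' : t.val = N * k := by nlinarith
  have hN : 0 < N := Nat.pos_of_ne_zero (NeZero.ne N)
  have hk2 : k < 2 := by
    by_contra! hk2
    nlinarith
  interval_cases k
  · left
    rw [← ZMod.natCast_zmod_val t, hk']
    simp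
  · right
    rw [← ZMod.natCast_zmod_val t, hk']
    simp

lemma quadGaussSum_mul_conj (N : ℕ) [NeZero N] {A D C : ZMod (2 * N)}
    (hAD : A * D = 1 + (N : ZMod (2 * N)) * C) (hAN : A * (N : ZMod (2 * N)) ^ 2 = 0) :
    quadGaussSum N A 0 * (starRingEnd ℂ) (quadGaussSum N A 0) = 4 * N := by
  have h2N : (2 : ZMod (2 * N)) * N = 0 := by
    exact_mod_cast ZMod.natCast_self (2 * N)
  have hN0 : (0 : ZMod (2 * N)) ≠ N := by
    intro h
    have := (ZMod.natCast_eq_zero_iff N (2 * N)).1 h.symm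
    have hN : 0 < N := Nat.pos_of_ne_zero (NeZero.ne N)
    have := Nat.le_of_dvd hN this
    omega
  have hzero (t : ZMod (2 * N)) : 2 * A * t = 0 ↔ t ∈ ({0, (N : ZMod (2 * N))} : Finset _) := by
    rw [Finset.mem_insert, Finset.mem_singleton]
    constructor
    · intro h
      apply ZMod.eq_zero_or_eq_of_two_mul_eq_zero
      linear_combination D * h - 2 * t * hAD - C * t * h2N
    · rintro (rfl | rfl)
      · simp
      · linear_combination A * h2N
  calc quadGaussSum N A 0 * (starRingEnd ℂ) (quadGaussSum N A 0)
      = ∑ y : ZMod (2 * N), ∑ x : ZMod (2 * N),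
          ZMod.stdAddChar (A * x ^ 2) * ZMod.stdAddChar (-(A * y ^ 2)) := by
        simp only [quadGaussSum, zero_mul, add_zero, map_sum, AddChar.map_neg_eq_conj]
        rw [Finset.sum_comm, Finset.sum_mul_sum]
    _ = ∑ y : ZMod (2 * N), ∑ t : ZMod (2 * N),
          ZMod.stdAddChar (A * t ^ 2) * ZMod.stdAddChar (y * (2 * A * t)) := by
        refine Finset.sum_congr rfl fun y _ ↦ ?_
        rw [← Equiv.sum_comp (Equiv.addRight y)]
        refine Finset.sum_congr rfl fun t _ ↦ ?_
        rw [← AddChar.map_add_eq_mul, ← AddChar.map_add_eq_mul]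
        congr 1
        simp only [Equiv.coe_addRight]
        ring
    _ = ∑ t : ZMod (2 * N), ZMod.stdAddChar (A * t ^ 2) *
          (if t ∈ ({0, (N : ZMod (2 * N))} : Finset _) then ((2 * N : ℕ) : ℂ) else 0) := by
        rw [Finset.sum_comm]
        refine Finset.sum_congr rfl fun t _ ↦ ?_
        rw [← Finset.mul_sum, AddChar.sum_mulShift _ (ZMod.isPrimitive_stdAddChar (2 * N)),
          ZMod.card]
        simp only [hzero]
        split_ifs <;> simp
    _ = 4 * N := by
        simp only [mul_ite, mul_zero]
        rw [Finset.sum_ite_mem, Finset.univ_inter, Finset.sum_pair hN0, hAN]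
        simp
        ring

lemma quadGaussSum_pow_four_eq_conj (N : ℕ) [NeZero N] (A : ZMod (2 * N)) :
    quadGaussSum N A 0 ^ 4 = (starRingEnd ℂ) (quadGaussSum N A 0) ^ 4 := by
  obtain ⟨x, y, z, w, h⟩ : ∃ x y z w : ZMod (2 * N), x ^ 2 + y ^ 2 + z ^ 2 + w ^ 2 = -1 := by
    obtain ⟨x, y, z, w, h⟩ := Nat.sum_four_squares (2 * N - 1)
    refine ⟨x, y, z, w, ?_⟩
    have hN : 0 < N := Nat.pos_of_ne_zero (NeZero.ne N)
    have h' : x ^ 2 + y ^ 2 + z ^ 2 + w ^ 2 + 1 = 2 * N := by omega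
    have h'' := congrArg (Nat.cast : ℕ → ZMod (2 * N)) h'
    rw [ZMod.natCast_self] at h''
    push_cast at h''
    linear_combination h''
  let R := ZMod (2 * N)
  let Q : R × R × R × R → R × R × R × R := fun v ↦
    (x * v.1 - y * v.2.1 - z * v.2.2.1 - w * v.2.2.2,
     x * v.2.1 + y * v.1 + z * v.2.2.2 - w * v.2.2.1,
     x * v.2.2.1 - y * v.2.2.2 + z * v.1 + w * v.2.1,
     x * v.2.2.2 + y * v.2.2.1 - z * v.2.1 + w * v.1)
  have hQ : Function.Bijective Q := by
    refine (Fintype.bijective_iff_injective_and_card Q).2 ⟨?_, rfl⟩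
    refine Function.LeftInverse.injective (g := fun u : R × R × R × R ↦
      (-(x * u.1 + y * u.2.1 + z * u.2.2.1 + w * u.2.2.2),
       -(x * u.2.1 - y * u.1 - z * u.2.2.2 + w * u.2.2.1),
       -(x * u.2.2.1 + y * u.2.2.2 - z * u.1 - w * u.2.1),
       -(x * u.2.2.2 - y * u.2.2.1 + z * u.2.1 - w * u.1))) ?_
    rintro ⟨a, b, c, d⟩
    simp only [Q, Prod.mk.injEq]
    refine ⟨?_, ?_, ?_, ?_⟩
    · linear_combination -a * h
    · linear_combination -b * h
    · linear_combination -c * h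
    · linear_combination -d * h
  have key (B : R) : (∑ x : R, (ZMod.stdAddChar (B * x ^ 2) : ℂ)) ^ 4 =
      ∑ v : R × R × R × R, (ZMod.stdAddChar
        (B * (v.1 ^ 2 + v.2.1 ^ 2 + v.2.2.1 ^ 2 + v.2.2.2 ^ 2)) : ℂ) := by
    simp only [Fintype.sum_prod_type, mul_add, AddChar.map_add_eq_mul, ← Finset.mul_sum,
      ← Finset.sum_mul]
    ring
  have hconj : (starRingEnd ℂ) (quadGaussSum N A 0) =
      ∑ x : R, (ZMod.stdAddChar (-A * x ^ 2) : ℂ) := by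
    simp only [quadGaussSum, zero_mul, add_zero, map_sum, neg_mul, AddChar.map_neg_eq_conj]
    rfl
  rw [hconj, key, ← (Equiv.ofBijective Q hQ).sum_comp]
  simp only [quadGaussSum, zero_mul, add_zero]
  refine (key A).trans (Finset.sum_congr rfl fun v _ ↦ ?_)
  congr 1
  simp only [Equiv.ofBijective_apply, Q]
  linear_combination A * (v.1 ^ 2 + v.2.1 ^ 2 + v.2.2.1 ^ 2 + v.2.2.2 ^ 2) * h

lemma quadGaussSum_pow_eight (N : ℕ) [NeZero N] {A D C : ZMod (2 * N)}
    (hAD : A * D = 1 + (N : ZMod (2 * N)) * C) (hAN : A * (N : ZMod (2 * N)) ^ 2 = 0) :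
    quadGaussSum N A 0 ^ 8 = (4 * N) ^ 4 := by
  rw [← quadGaussSum_mul_conj N hAD hAN, mul_pow, ← quadGaussSum_pow_four_eq_conj]
  ring

/-- Completing the square. -/
lemma quadGaussSum_sub_two_mul (N : ℕ) [NeZero N] {A D C : ZMod (2 * N)}
    (hAD : A * D = 1 + (N : ZMod (2 * N)) * C) (s k : ZMod (2 * N)) :
    quadGaussSum N A (s - 2 * k) =
      ZMod.stdAddChar (s * D * k - D * k ^ 2 + (N : ZMod (2 * N)) * C * D * k ^ 2) * quadGaussSum N A s := by
  have h2N : (2 : ZMod (2 * N)) * N = 0 := by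
    exact_mod_cast ZMod.natCast_self (2 * N)
  rw [quadGaussSum, quadGaussSum, Finset.mul_sum]
  rw [← Equiv.sum_comp (Equiv.addRight (D * k))]
  refine Finset.sum_congr rfl fun r _ ↦ ?_
  rw [← AddChar.map_add_eq_mul]
  congr 1
  simp only [Equiv.coe_addRight]
  linear_combination (2 * r * k + D * k ^ 2) * hAD + C * r * k * h2N

lemma hasTemperateGrowth_cexp_I_mul :
    Function.HasTemperateGrowth (fun t : ℝ ↦ Complex.exp (Complex.I * t)) := by
  have hderiv (n : ℕ) : iteratedDeriv n (fun t : ℝ ↦ Complex.exp (Complex.I * t)) =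
      fun t : ℝ ↦ Complex.I ^ n * Complex.exp (Complex.I * t) := by
    induction n with
    | zero => simp
    | succ n ih =>
      rw [iteratedDeriv_succ, ih]
      funext t
      have h : HasDerivAt (fun t : ℝ ↦ Complex.I ^ n * Complex.exp (Complex.I * t))
          (Complex.I ^ n * (Complex.exp (Complex.I * t) * (Complex.I * 1))) t :=
        (((Complex.ofRealCLM.hasDerivAt (x := t)).const_mul Complex.I).cexp).const_mul _
      rw [h.deriv]
      ring
  refine ⟨?_, fun n ↦ ⟨0, 1, fun t ↦ ?_⟩⟩
  · exact Complex.contDiff_exp.comp (contDiff_const.mul Complex.ofRealCLM.contDiff)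
  · rw [norm_iteratedFDeriv_eq_norm_iteratedDeriv, hderiv]
    simp [Complex.norm_exp]

/-- Multiplication of a Schwartz function by the chirp `exp(i(u x² + v x))`. -/
noncomputable def SchwartzMap.chirp (u v : ℝ) (f : 𝓢(ℝ, ℂ)) : 𝓢(ℝ, ℂ) :=
  SchwartzMap.smulLeftCLM ℂ
    (fun x : ℝ ↦ Complex.exp (Complex.I * ((u * x ^ 2 + v * x : ℝ) : ℂ))) f

lemma SchwartzMap.chirp_apply (u v : ℝ) (f : 𝓢(ℝ, ℂ)) (x : ℝ) :
    SchwartzMap.chirp u v f x =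
      Complex.exp (Complex.I * ((u * x ^ 2 + v * x : ℝ) : ℂ)) * f x := by
  have hpoly : Function.HasTemperateGrowth (fun x : ℝ ↦ u * x ^ 2 + v * x) := by fun_prop
  have h : Function.HasTemperateGrowth
      (fun x : ℝ ↦ Complex.exp (Complex.I * ((u * x ^ 2 + v * x : ℝ) : ℂ))) :=
    hasTemperateGrowth_cexp_I_mul.comp hpoly
  rw [SchwartzMap.chirp, SchwartzMap.smulLeftCLM_apply_apply h, smul_eq_mul]

lemma SchwartzMap.summable_comp_div (f : 𝓢(ℝ, ℂ)) {b : ℝ} (hb : b ≠ 0) :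
    Summable fun n : ℤ ↦ f (n / b) := by
  have ht : Filter.Tendsto (fun n : ℤ ↦ (n : ℝ) / b) Filter.cofinite (Filter.cocompact ℝ) :=
    ((Homeomorph.mulRight₀ b⁻¹ (inv_ne_zero hb)).isClosedEmbedding.tendsto_cocompact).comp
      Int.tendsto_coe_cofinite
  have hs : Summable fun n : ℤ ↦ ‖(n : ℝ) / b‖ ^ (-2 : ℝ) := by
    have := (Real.summable_abs_int_rpow (b := 2) one_lt_two).mul_right (|b| ^ (2 : ℝ))
    refine this.congr fun n ↦ ?_
    rw [Real.norm_eq_abs, abs_div, Real.div_rpow (abs_nonneg _) (abs_nonneg _),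
      Real.rpow_neg (abs_nonneg b), div_inv_eq_mul]
  exact summable_of_isBigO hs ((f.isBigO_cocompact_rpow (-2)).comp_tendsto ht)

lemma SchwartzMap.summable_int (f : 𝓢(ℝ, ℂ)) : Summable fun n : ℤ ↦ f n := by
  simpa using f.summable_comp_div one_ne_zero

/-- Poisson summation on a shifted lattice in frequency space. -/
lemma SchwartzMap.tsum_fourier_add (F : 𝓢(ℝ, ℂ)) (x : ℝ) :
    ∑' m : ℤ, 𝓕 (F : ℝ → ℂ) (x + m) =
      ∑' k : ℤ, F k * Complex.exp (-(2 * Real.pi * Complex.I * x * k)) := by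
  have h := (SchwartzMap.chirp 0 (-(2 * Real.pi * x)) F).tsum_eq_tsum_fourier 0
  simp only [zero_add, SchwartzMap.fourier_coe] at h
  refine Eq.trans ?_ (h.symm.trans ?_)
  · refine tsum_congr fun m ↦ ?_
    rw [fourier_coe_apply]
    simp only [Complex.ofReal_zero, mul_zero, zero_div, Complex.exp_zero, mul_one]
    rw [Real.fourier_eq', Real.fourier_eq']
    refine integral_congr_ae (.of_forall fun z ↦ ?_)
    simp only [SchwartzMap.chirp_apply, smul_eq_mul]
    rw [← mul_assoc, ← Complex.exp_add]
    congr 2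
    simp
    ring
  · refine tsum_congr fun k ↦ ?_
    rw [SchwartzMap.chirp_apply, mul_comm]
    congr 2
    push_cast
    ring

/-- Poisson summation for the Fourier transform sampled at `ℤ/b` with periodic weights. -/
lemma SchwartzMap.tsum_periodic_mul_fourier (F : 𝓢(ℝ, ℂ)) (b : ℤ) (hb : b ≠ 0) (w : ℤ → ℂ)
    (hw : ∀ n, ‖w n‖ = 1) (hper : ∀ n m, w (n + b * m) = w n) :
    ∑' n : ℤ, w n * 𝓕 (F : ℝ → ℂ) (n / b) =
      ∑' k : ℤ, F k * ∑ r ∈ Finset.range b.natAbs,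
        w r * Complex.exp (-(2 * Real.pi * Complex.I * r * k / b)) := by
  have : NeZero b.natAbs := ⟨Int.natAbs_ne_zero.2 hb⟩
  have hbR : (b : ℝ) ≠ 0 := by exact_mod_cast hb
  have hbC : (b : ℂ) ≠ 0 := by exact_mod_cast hb
  have hsum : Summable fun n : ℤ ↦ w n * 𝓕 (F : ℝ → ℂ) (n / b) := by
    refine Summable.of_norm ?_
    simp only [norm_mul, hw, one_mul]
    exact ((𝓕 F).summable_comp_div hbR).norm
  have hσ : b.sign * b.natAbs = b := Int.sign_mul_natAbs b
  have hσσ : b.sign * b.sign = 1 := by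
    rcases hb.lt_or_gt with h | h
    · simp [Int.sign_eq_neg_one_of_neg h]
    · simp [Int.sign_eq_one_of_pos h]
  have hinv : Function.Involutive fun m : ℤ ↦ b.sign * m := fun m ↦ by
    linear_combination m * hσσ
  let σ : ℤ ≃ ℤ := hinv.toPerm
  let e : ℤ × Fin b.natAbs ≃ ℤ :=
    (σ.prodCongr (Equiv.refl _)).trans (Int.divModEquiv b.natAbs).symm
  have he (m : ℤ) (r : Fin b.natAbs) : e (m, r) = (r : ℕ) + b * m := by
    simp only [e, σ, Equiv.trans_apply, Equiv.prodCongr_apply, Prod.map, Function.Involutive.coe_toPerm,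
      Equiv.refl_apply, Int.divModEquiv_symm_apply]
    linear_combination m * hσ
  have hsum' := (e.summable_iff (f := fun n : ℤ ↦ w n * 𝓕 (F : ℝ → ℂ) (n / b))).2 hsum
  calc ∑' n : ℤ, w n * 𝓕 (F : ℝ → ℂ) (n / b)
      = ∑' x : ℤ × Fin b.natAbs, w (e x) * 𝓕 (F : ℝ → ℂ) ((e x : ℤ) / b) := (e.tsum_eq _).symm
    _ = ∑ r : Fin b.natAbs, ∑' m : ℤ, w (e (m, r)) * 𝓕 (F : ℝ → ℂ) ((e (m, r) : ℤ) / b) := by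
        rw [← (Equiv.prodComm _ _).tsum_eq]
        rw [Summable.tsum_prod, tsum_fintype]
        · rfl
        · exact (Equiv.prodComm _ _).summable_iff.2 hsum'
    _ = ∑ r : Fin b.natAbs, w (r : ℕ) * ∑' m : ℤ, 𝓕 (F : ℝ → ℂ) ((r : ℕ) / b + m) := by
        refine Finset.sum_congr rfl fun r _ ↦ ?_
        rw [← tsum_mul_left]
        refine tsum_congr fun m ↦ ?_
        rw [he, hper]
        congr 2
        push_cast
        field_simp
    _ = ∑ r ∈ Finset.range b.natAbs, ∑' k : ℤ,
          F k * (w r * Complex.exp (-(2 * Real.pi * Complex.I * r * k / b))) := by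
        rw [Finset.sum_range]
        refine Finset.sum_congr rfl fun r _ ↦ ?_
        rw [SchwartzMap.tsum_fourier_add, ← tsum_mul_left]
        refine tsum_congr fun k ↦ ?_
        rw [mul_left_comm]
        congr 4
        push_cast
        ring
    _ = _ := by
        rw [← Summable.tsum_finsetSum]
        · simp only [Finset.mul_sum]
        · intro r _
          refine Summable.of_norm ?_
          refine F.summable_int.norm.congr fun k ↦ ?_
          have : Complex.exp (-(2 * Real.pi * Complex.I * r * k / b)) =
              Complex.exp ((-(2 * Real.pi * r * k / b) : ℝ) * Complex.I) := by
            congr 1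
            push_cast
            ring
          rw [norm_mul, norm_mul, hw, this, Complex.norm_exp_ofReal_mul_I, one_mul, mul_one]

lemma ZMod.sum_eq_sum_range {M : Type*} [AddCommMonoid M] (n : ℕ) [NeZero n] (g : ZMod n → M) :
    ∑ x, g x = ∑ r ∈ Finset.range n, g r := by
  refine Finset.sum_nbij' ZMod.val (fun r : ℕ ↦ (r : ZMod n)) ?_ ?_ ?_ ?_ ?_
  · exact fun x _ ↦ Finset.mem_range.2 x.val_lt
  · simp
  · simp
  · exact fun r hr ↦ ZMod.val_cast_of_lt (Finset.mem_range.1 hr)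
  · simp

lemma Complex.exp_pi_mul_I_mul_even {j : ℤ} (hj : Even j) :
    Complex.exp (Real.pi * Complex.I * j) = 1 := by
  obtain ⟨k, rfl⟩ := hj
  rw [← Complex.exp_int_mul_two_pi_mul_I k]
  congr 1
  push_cast
  ring

/-- The generalized quadratic Gauss sum `∑ exp(πi(a r² + q r)/b)` over residues modulo `b`. -/
noncomputable def chirpGaussSum (a q b : ℤ) : ℂ :=
  ∑ r ∈ Finset.range b.natAbs,
    Complex.exp (Real.pi * Complex.I * ((a * r ^ 2 + q * r : ℤ) : ℂ) / b)

lemma exp_pi_mul_I_mul_div_eq_stdAddChar (b j : ℤ) [NeZero b.natAbs] :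
    Complex.exp (Real.pi * Complex.I * j / b) =
      ZMod.stdAddChar ((b.sign * j : ℤ) : ZMod (2 * b.natAbs)) := by
  have hN : (b.natAbs : ℂ) ≠ 0 := by exact_mod_cast NeZero.ne b.natAbs
  have hb : (b : ℂ) ≠ 0 := by
    exact_mod_cast Int.natAbs_ne_zero.1 (NeZero.ne b.natAbs)
  have hσ : ((b.sign : ℤ) : ℂ) * b = b.natAbs := by
    simpa only [Int.cast_add, Int.cast_sub, Int.cast_mul, Int.cast_pow, Int.cast_natCast,
      Int.cast_one, Int.cast_zero] using
      congrArg (Int.cast : ℤ → ℂ) (Int.sign_mul_self_eq_natAbs b)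
  rw [ZMod.stdAddChar_coe]
  congr 1
  push_cast
  rw [div_eq_div_iff hb (mul_ne_zero two_ne_zero hN)]
  linear_combination (-2 * Real.pi * Complex.I * j) * hσ

lemma exp_chirp_add_mul (a q b : ℤ) (hb : b ≠ 0) (hq : q ≡ a * b [ZMOD 2]) (n m : ℤ) :
    Complex.exp (Real.pi * Complex.I *
        ((a * (n + b * m) ^ 2 + q * (n + b * m) : ℤ) : ℂ) / b) =
      Complex.exp (Real.pi * Complex.I * ((a * n ^ 2 + q * n : ℤ) : ℂ) / b) := by
  have hbC : (b : ℂ) ≠ 0 := by exact_mod_cast hb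
  have heven : Even (2 * a * n * m + a * b * m ^ 2 + q * m) := by
    have h : Even (q - a * b) := by
      rw [even_iff_two_dvd]
      exact hq.symm.dvd
    have h' : Even (m * (m + 1)) := Int.even_mul_succ_self m
    have : 2 * a * n * m + a * b * m ^ 2 + q * m =
        2 * (a * n * m) + (q - a * b) * m + a * b * (m * (m + 1)) := by ring
    rw [this]
    exact ((even_two_mul _).add (h.mul_right _)).add (h'.mul_left _)
  rw [← mul_one (Complex.exp (Real.pi * Complex.I * ((a * n ^ 2 + q * n : ℤ) : ℂ) / b)),
    ← Complex.exp_pi_mul_I_mul_even heven, ← Complex.exp_add]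
  congr 1
  push_cast
  field_simp
  ring

lemma quadGaussSum_eq_two_mul_chirpGaussSum (a q b : ℤ) [NeZero b.natAbs]
    (hq : q ≡ a * b [ZMOD 2]) :
    quadGaussSum b.natAbs ((b.sign * a : ℤ) : ZMod (2 * b.natAbs))
      ((b.sign * q : ℤ) : ZMod (2 * b.natAbs)) = 2 * chirpGaussSum a q b := by
  have hb : b ≠ 0 := Int.natAbs_ne_zero.1 (NeZero.ne b.natAbs)
  have hσ : b * b.sign = b.natAbs := by rw [mul_comm, Int.sign_mul_self_eq_natAbs]
  have hterm (r : ℕ) : (ZMod.stdAddChar (((b.sign * a : ℤ) : ZMod (2 * b.natAbs)) * (r : ZMod (2 * b.natAbs)) ^ 2 +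
      ((b.sign * q : ℤ) : ZMod (2 * b.natAbs)) * (r : ZMod (2 * b.natAbs))) : ℂ) =
      Complex.exp (Real.pi * Complex.I * ((a * r ^ 2 + q * r : ℤ) : ℂ) / b) := by
    rw [exp_pi_mul_I_mul_div_eq_stdAddChar]
    congr 1
    push_cast
    ring
  rw [quadGaussSum, ZMod.sum_eq_sum_range]
  simp only [hterm]
  rw [two_mul b.natAbs, Finset.sum_range_add, two_mul, chirpGaussSum]
  congr 1
  refine Finset.sum_congr rfl fun r _ ↦ ?_
  rw [← exp_chirp_add_mul a q b hb hq r b.sign, hσ]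
  push_cast
  congr 4 <;> ring

/-- Completing the square in a generalized quadratic Gauss sum. -/
lemma chirpGaussSum_sub_two_mul {a b c d q : ℤ} (hb : b ≠ 0) (hdet : a * d - b * c = 1)
    (hq : q ≡ a * b [ZMOD 2]) (k : ℤ) :
    chirpGaussSum a (q - 2 * k) b =
      Complex.exp (Real.pi * Complex.I *
        ((q * d * k - d * k ^ 2 + b * c * d * k ^ 2 : ℤ) : ℂ) / b) * chirpGaussSum a q b := by
  have : NeZero b.natAbs := ⟨Int.natAbs_ne_zero.2 hb⟩
  have hσσ : b.sign * b.sign = 1 := by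
    rcases hb.lt_or_gt with h | h
    · simp [Int.sign_eq_neg_one_of_neg h]
    · simp [Int.sign_eq_one_of_pos h]
  have hσ := Int.sign_mul_self_eq_natAbs b
  have hq' : q - 2 * k ≡ a * b [ZMOD 2] := by
    refine Int.ModEq.trans ?_ hq
    exact (Int.modEq_iff_dvd.2 ⟨k, by ring⟩)
  have hAD : ((b.sign * a : ℤ) : ZMod (2 * b.natAbs)) * ((b.sign * d : ℤ) : ZMod (2 * b.natAbs)) =
      1 + (b.natAbs : ZMod (2 * b.natAbs)) * ((b.sign * c : ℤ) : ZMod (2 * b.natAbs)) := by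
    have : b.sign * a * (b.sign * d) = 1 + (b.natAbs : ℤ) * (b.sign * c) := by
      rw [← hσ]
      linear_combination (a * d - b * c) * hσσ + hdet
    simpa only [Int.cast_add, Int.cast_sub, Int.cast_mul, Int.cast_pow, Int.cast_natCast,
      Int.cast_one, Int.cast_zero] using
      congrArg (Int.cast : ℤ → ZMod (2 * b.natAbs)) this
  have h := quadGaussSum_sub_two_mul b.natAbs hAD ((b.sign * q : ℤ) : ZMod (2 * b.natAbs))
    ((b.sign * k : ℤ) : ZMod (2 * b.natAbs))
  have h1 : ((b.sign * q : ℤ) : ZMod (2 * b.natAbs)) - 2 * ((b.sign * k : ℤ) : ZMod (2 * b.natAbs))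
      = ((b.sign * (q - 2 * k) : ℤ) : ZMod (2 * b.natAbs)) := by
    push_cast
    ring
  rw [h1, quadGaussSum_eq_two_mul_chirpGaussSum _ _ _ hq',
    quadGaussSum_eq_two_mul_chirpGaussSum _ _ _ hq, mul_left_comm] at h
  rw [mul_left_cancel₀ two_ne_zero h, exp_pi_mul_I_mul_div_eq_stdAddChar]
  congr 2
  have : b.sign * q * (b.sign * d) * (b.sign * k) - b.sign * d * (b.sign * k) ^ 2 +
      (b.natAbs : ℤ) * (b.sign * c) * (b.sign * d) * (b.sign * k) ^ 2 =
      b.sign * (q * d * k - d * k ^ 2 + b * c * d * k ^ 2) := by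
    rw [← hσ]
    linear_combination (b.sign * (q * d * k - d * k ^ 2 + b * c * d * k ^ 2) +
      b.sign ^ 3 * b * c * d * k ^ 2) * hσσ
  simpa only [Int.cast_add, Int.cast_sub, Int.cast_mul, Int.cast_pow, Int.cast_natCast,
      Int.cast_one, Int.cast_zero] using
      congrArg (Int.cast : ℤ → ZMod (2 * b.natAbs)) this

lemma chirpGaussSum_pow_eight_of_even {a b c d q : ℤ} (hb : b ≠ 0) (hdet : a * d - b * c = 1)
    (hq : q ≡ a * b [ZMOD 2]) (heven : Even q) :
    Complex.exp (2 * Real.pi * Complex.I * d * q ^ 2 / b) * chirpGaussSum a q b ^ 8 =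
      (b : ℂ) ^ 4 := by
  have : NeZero b.natAbs := ⟨Int.natAbs_ne_zero.2 hb⟩
  have hbC : (b : ℂ) ≠ 0 := by exact_mod_cast hb
  have hσσ : b.sign * b.sign = 1 := by
    rcases hb.lt_or_gt with h | h
    · simp [Int.sign_eq_neg_one_of_neg h]
    · simp [Int.sign_eq_one_of_pos h]
  have hσ := Int.sign_mul_self_eq_natAbs b
  obtain ⟨k, rfl⟩ := heven
  have hab : (0 : ℤ) ≡ a * b [ZMOD 2] := by
    refine Int.ModEq.trans ?_ hq
    exact (Int.modEq_iff_dvd.2 ⟨k, by ring⟩)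
  have hAD : ((b.sign * a : ℤ) : ZMod (2 * b.natAbs)) * ((b.sign * d : ℤ) : ZMod (2 * b.natAbs)) =
      1 + (b.natAbs : ZMod (2 * b.natAbs)) * ((b.sign * c : ℤ) : ZMod (2 * b.natAbs)) := by
    have : b.sign * a * (b.sign * d) = 1 + (b.natAbs : ℤ) * (b.sign * c) := by
      rw [← hσ]
      linear_combination (a * d - b * c) * hσσ + hdet
    simpa only [Int.cast_add, Int.cast_sub, Int.cast_mul, Int.cast_pow, Int.cast_natCast,
      Int.cast_one, Int.cast_zero] using
      congrArg (Int.cast : ℤ → ZMod (2 * b.natAbs)) this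
  have hAN : ((b.sign * a : ℤ) : ZMod (2 * b.natAbs)) * (b.natAbs : ZMod (2 * b.natAbs)) ^ 2
      = 0 := by
    obtain ⟨m, hm⟩ := Int.modEq_iff_dvd.1 hab
    have h1 : b.sign * a * (b.natAbs : ℤ) ^ 2 = ((2 * b.natAbs : ℕ) : ℤ) * m := by
      rw [Nat.cast_mul, Nat.cast_ofNat, ← hσ]
      linear_combination b.sign * b * hm + b.sign * b ^ 2 * a * hσσ
    have h2 := congrArg (Int.cast : ℤ → ZMod (2 * b.natAbs)) h1
    rw [Int.cast_mul ((2 * b.natAbs : ℕ) : ℤ), Int.cast_natCast, ZMod.natCast_self, zero_mul] at h2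
    simpa only [Int.cast_add, Int.cast_sub, Int.cast_mul, Int.cast_pow, Int.cast_natCast,
      Int.cast_one, Int.cast_zero] using h2
  have h8 := quadGaussSum_pow_eight b.natAbs hAD hAN
  have h2 := quadGaussSum_eq_two_mul_chirpGaussSum a 0 b hab
  rw [mul_zero, Int.cast_zero] at h2
  have hsq := chirpGaussSum_sub_two_mul hb hdet hq k
  rw [show k + k - 2 * k = 0 by ring] at hsq
  have hN : (b.natAbs : ℂ) ^ 4 = (b : ℂ) ^ 4 := by
    have : (b.natAbs : ℤ) ^ 4 = b ^ 4 := by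
      rw [← hσ]
      linear_combination b ^ 4 * (b.sign ^ 2 + 1) * hσσ
    simpa only [Int.cast_add, Int.cast_sub, Int.cast_mul, Int.cast_pow, Int.cast_natCast,
      Int.cast_one, Int.cast_zero] using congrArg (Int.cast : ℤ → ℂ) this
  rw [h2, hsq, mul_pow, mul_pow, mul_pow, hN, ← Complex.exp_nat_mul] at h8
  have hphase : Complex.exp ((8 : ℕ) * (Real.pi * Complex.I *
      (((k + k) * d * k - d * k ^ 2 + b * c * d * k ^ 2 : ℤ) : ℂ) / b)) =
      Complex.exp (2 * Real.pi * Complex.I * d * ((k + k : ℤ) : ℂ) ^ 2 / b) := by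
    rw [← mul_one (Complex.exp (2 * _ * _ * _ * _ / _)),
      ← Complex.exp_pi_mul_I_mul_even (even_two_mul (4 * c * d * k ^ 2)), ← Complex.exp_add]
    congr 1
    push_cast
    field_simp
    ring
  rw [hphase] at h8
  linear_combination h8 / 256

/-- The generalized quadratic Gauss sum is, up to an explicit phase and the factor `√|b|`,
an eighth root of unity. -/
lemma chirpGaussSum_pow_eight {a b c d q : ℤ} (hb : b ≠ 0) (hdet : a * d - b * c = 1)
    (hq : q ≡ a * b [ZMOD 2]) :
    Complex.exp (2 * Real.pi * Complex.I * d * q ^ 2 / b) * chirpGaussSum a q b ^ 8 =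
      (b : ℂ) ^ 4 := by
  rcases Int.even_or_odd q with he | ho
  · exact chirpGaussSum_pow_eight_of_even hb hdet hq he
  have hbC : (b : ℂ) ≠ 0 := by exact_mod_cast hb
  have hab : Odd (a * b) := by
    rw [Int.odd_iff] at ho ⊢
    rw [← ho]
    exact hq.symm
  have hbo : Odd b := (Int.odd_mul.1 hab).2
  have hao : Odd a := (Int.odd_mul.1 hab).1
  have hqe : Even (q + b) := ho.add_odd hbo
  have hq' : q + b ≡ (a + b) * b [ZMOD 2] := by
    have : Even ((a + b) * b) := (hao.add_odd hbo).mul_right b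
    rw [Int.even_iff] at hqe this
    exact hqe.trans this.symm
  have h := chirpGaussSum_pow_eight_of_even (c := c + d) (d := d) hb
    (by linear_combination hdet) hq' hqe
  have hsum : chirpGaussSum (a + b) (q + b) b = chirpGaussSum a q b := by
    refine Finset.sum_congr rfl fun r _ ↦ ?_
    rw [← mul_one (Complex.exp (Real.pi * Complex.I * ((a * r ^ 2 + q * r : ℤ) : ℂ) / b)),
      ← Complex.exp_pi_mul_I_mul_even (Int.even_mul_succ_self r), ← Complex.exp_add]
    congr 1
    push_cast
    field_simp
    ring
  have hphase : Complex.exp (2 * Real.pi * Complex.I * d * ((q + b : ℤ) : ℂ) ^ 2 / b) =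
      Complex.exp (2 * Real.pi * Complex.I * d * q ^ 2 / b) := by
    rw [← mul_one (Complex.exp (2 * Real.pi * Complex.I * d * q ^ 2 / b)),
      ← Complex.exp_pi_mul_I_mul_even (even_two_mul (2 * d * q + d * b)), ← Complex.exp_add]
    congr 1
    push_cast
    field_simp
    ring
  rwa [hsum, hphase] at h

/-- The chirped Gauss sum is constant along the integers. -/
lemma exp_chirp_mul_sum_eq_chirpGaussSum {a b c d q p : ℤ} (hb : b ≠ 0)
    (hdet : a * d - b * c = 1) (hq : q ≡ a * b [ZMOD 2]) (hp : p ≡ c * d [ZMOD 2]) (k : ℤ) :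
    Complex.exp (Complex.I * ((Real.pi * d / b * (k : ℝ) ^ 2 +
        (Real.pi * p - Real.pi * d * q / b) * k : ℝ) : ℂ)) *
      ∑ r ∈ Finset.range b.natAbs,
        Complex.exp (Real.pi * Complex.I * ((a * (r : ℤ) ^ 2 + q * (r : ℤ) : ℤ) : ℂ) / b) *
          Complex.exp (-(2 * Real.pi * Complex.I * r * k / b)) =
      chirpGaussSum a q b := by
  have hbC : (b : ℂ) ≠ 0 := by exact_mod_cast hb
  have hsum : ∑ r ∈ Finset.range b.natAbs,
        Complex.exp (Real.pi * Complex.I * ((a * (r : ℤ) ^ 2 + q * (r : ℤ) : ℤ) : ℂ) / b) *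
          Complex.exp (-(2 * Real.pi * Complex.I * r * k / b)) =
      chirpGaussSum a (q - 2 * k) b := by
    refine Finset.sum_congr rfl fun r _ ↦ ?_
    rw [← Complex.exp_add]
    congr 1
    push_cast
    field_simp
    ring
  have heven : Even (p * k + c * d * k ^ 2) := by
    have h : Even (p - c * d) := by
      rw [even_iff_two_dvd]
      exact hp.symm.dvd
    have : p * k + c * d * k ^ 2 = (p - c * d) * k + c * d * (k * (k + 1)) := by ring
    rw [this]
    exact (h.mul_right _).add ((Int.even_mul_succ_self k).mul_left _)
  rw [hsum, chirpGaussSum_sub_two_mul hb hdet hq, ← mul_assoc, ← Complex.exp_add]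
  conv_rhs => rw [← one_mul (chirpGaussSum a q b), ← Complex.exp_pi_mul_I_mul_even heven]
  congr 2
  push_cast
  field_simp
  ring

/-- The metaplectic image of the shifted Schwartz function, as a sampled Fourier transform. -/
lemma metaplectic_shift_eq_fourier {a b c d q p : ℤ} (hb : b ≠ 0) (f : 𝓢(ℝ, ℂ)) (n : ℤ) :
    metaplectic d b c a
      (fun x => Complex.exp ((Real.pi : ℂ) * Complex.I * ((q : ℝ) : ℂ) * ((p : ℝ) : ℂ) / 4
        + (Real.pi : ℂ) * Complex.I * ((p : ℝ) : ℂ) * (x : ℂ)) * f (x + (q : ℝ) / 2)) (n : ℝ) =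
    (Complex.I * b) ^ (-(1 / 2) : ℂ) *
        Complex.exp (Real.pi * Complex.I * (d * q ^ 2 / (4 * b) - q * p / 4)) *
      (Complex.exp (Real.pi * Complex.I * ((a * n ^ 2 + q * n : ℤ) : ℂ) / b) *
        𝓕 (SchwartzMap.chirp (Real.pi * d / b) (Real.pi * p - Real.pi * d * q / b) f : ℝ → ℂ)
          (n / b)) := by
  have hbC : (b : ℂ) ≠ 0 := by exact_mod_cast hb
  rw [metaplectic, if_pos (by exact_mod_cast hb)]
  rw [← integral_sub_right_eq_self (μ := (volume : Measure ℝ)) (E := ℂ) _ ((q : ℝ) / 2),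
    Real.fourier_eq', mul_assoc ((Complex.I * (b : ℂ)) ^ (-(1 / 2) : ℂ))]
  simp only [Complex.ofReal_intCast]
  rw [← integral_const_mul, ← integral_const_mul, ← integral_const_mul, ← integral_const_mul]
  refine integral_congr_ae (.of_forall fun z ↦ ?_)
  simp only [sub_add_cancel, SchwartzMap.chirp_apply, smul_eq_mul]
  congr 1
  simp only [← mul_assoc, ← Complex.exp_add]
  congr 2
  simp
  field_simp
  ring

lemma shiftMetaPair_of_ne_zero {a b c d q p : ℤ} (hb : b ≠ 0) (hdet : a * d - b * c = 1)
    (hq : q ≡ a * b [ZMOD 2]) (hp : p ≡ c * d [ZMOD 2]) (f : 𝓢(ℝ, ℂ)) :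
    shiftMetaPair a b c d q p f =
      (Complex.I * b) ^ (-(1 / 2) : ℂ) *
        Complex.exp (Real.pi * Complex.I * (d * q ^ 2 / (4 * b) - q * p / 4)) *
        chirpGaussSum a q b * ∑' n : ℤ, f n := by
  rw [shiftMetaPair]
  simp only [metaplectic_shift_eq_fourier hb]
  rw [tsum_mul_left, SchwartzMap.tsum_periodic_mul_fourier _ b hb
    (fun n ↦ Complex.exp (Real.pi * Complex.I * ((a * n ^ 2 + q * n : ℤ) : ℂ) / b)),
    mul_assoc _ (chirpGaussSum a q b)]
  · congr 1
    rw [← tsum_mul_left]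
    refine tsum_congr fun k ↦ ?_
    rw [SchwartzMap.chirp_apply, mul_right_comm, exp_chirp_mul_sum_eq_chirpGaussSum hb hdet hq hp]
  · intro n
    have : (Real.pi * Complex.I * ((a * n ^ 2 + q * n : ℤ) : ℂ) / b) =
        ((Real.pi * (a * n ^ 2 + q * n : ℤ) / b : ℝ) : ℂ) * Complex.I := by
      push_cast
      ring
    rw [this, Complex.norm_exp_ofReal_mul_I]
  · exact exp_chirp_add_mul a q b hb hq

lemma eigenvalue_pow_eight {a b c d q p : ℤ} (hb : b ≠ 0) (hdet : a * d - b * c = 1)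
    (hq : q ≡ a * b [ZMOD 2]) :
    ((Complex.I * b) ^ (-(1 / 2) : ℂ) *
        Complex.exp (Real.pi * Complex.I * (d * q ^ 2 / (4 * b) - q * p / 4)) *
        chirpGaussSum a q b) ^ 8 = 1 := by
  have hbC : (b : ℂ) ≠ 0 := by exact_mod_cast hb
  have h1 : ((Complex.I * b) ^ (-(1 / 2) : ℂ)) ^ 8 = ((b : ℂ) ^ 4)⁻¹ := by
    rw [← Complex.cpow_nat_mul,
      show ((8 : ℕ) : ℂ) * (-(1 / 2)) = ((-4 : ℤ) : ℂ) by norm_num, Complex.cpow_intCast,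
      zpow_neg]
    norm_cast
    rw [mul_pow, Complex.I_pow_four, one_mul]
    norm_cast
  have h2 : Complex.exp (Real.pi * Complex.I * (d * q ^ 2 / (4 * b) - q * p / 4)) ^ 8 =
      Complex.exp (2 * Real.pi * Complex.I * d * q ^ 2 / b) := by
    rw [← Complex.exp_nat_mul, ← mul_one (Complex.exp (2 * Real.pi * Complex.I * d * q ^ 2 / b)),
      ← Complex.exp_pi_mul_I_mul_even (even_two_mul (-(q * p))), ← Complex.exp_add]
    congr 1
    push_cast
    field_simp
    ring
  rw [mul_pow, mul_pow, h1, h2, mul_assoc, chirpGaussSum_pow_eight hb hdet hq]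
  exact inv_mul_cancel₀ (pow_ne_zero 4 hbC)

/-- The metaplectic image of the shifted function when `b = 0`, so that `d = ±1`. -/
lemma metaplectic_shift_of_eq_zero {c d q p : ℤ} (hd : d * d = 1) {k : ℤ} (hq : q = 2 * k)
    (hp : p ≡ c * d [ZMOD 2]) (f : ℝ → ℂ) (n : ℤ) :
    metaplectic d 0 c d
      (fun x => Complex.exp ((Real.pi : ℂ) * Complex.I * ((q : ℝ) : ℂ) * ((p : ℝ) : ℂ) / 4
        + (Real.pi : ℂ) * Complex.I * ((p : ℝ) : ℂ) * (x : ℂ)) * f (x + (q : ℝ) / 2)) (n : ℝ) =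
    (if 0 < d then 1 else -Complex.I) * Complex.exp (Real.pi * Complex.I * (k * p / 2)) *
      f ((d * n + k : ℤ) : ℝ) := by
  have heven : Even (c * d * n ^ 2 + p * d * n) := by
    have h : Even (p - c * d) := by
      rw [even_iff_two_dvd]
      exact hp.symm.dvd
    have : c * d * n ^ 2 + p * d * n = c * d * (n * (n + 1)) + (p - c * d) * (d * n)
        + c * n * ((d - 1) * ((d - 1) + 1)) := by ring
    rw [this]
    exact (((Int.even_mul_succ_self n).mul_left _).add (h.mul_right _)).add
      ((Int.even_mul_succ_self (d - 1)).mul_left _)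
  have key : Complex.exp (Real.pi * Complex.I * (((c : ℝ) / (d : ℝ) : ℝ) : ℂ) * ((n : ℝ) : ℂ) ^ 2) *
      (Complex.exp ((Real.pi : ℂ) * Complex.I * ((q : ℝ) : ℂ) * ((p : ℝ) : ℂ) / 4
        + (Real.pi : ℂ) * Complex.I * ((p : ℝ) : ℂ) * (((n : ℝ) / (d : ℝ) : ℝ) : ℂ)) *
        f ((n : ℝ) / d + (q : ℝ) / 2)) =
      Complex.exp (Real.pi * Complex.I * (k * p / 2)) * f ((d * n + k : ℤ) : ℝ) := by
    have hinv : ∀ x : ℝ, x / (d : ℝ) = x * d := by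
      intro x
      have : (d : ℝ) * d = 1 := by exact_mod_cast hd
      rw [div_eq_iff (left_ne_zero_of_mul_eq_one this), mul_assoc, this, mul_one]
    rw [← mul_assoc, ← Complex.exp_add, hinv, hinv, hq]
    congr 1
    · rw [← mul_one (Complex.exp (Real.pi * Complex.I * (k * p / 2))),
        ← Complex.exp_pi_mul_I_mul_even heven, ← Complex.exp_add]
      congr 1
      push_cast
      ring
    · congr 1
      push_cast
      ring
  rw [metaplectic, if_neg (by simp)]
  rcases Int.eq_one_or_neg_one_of_mul_eq_one hd with rfl | rfl
  · rw [if_pos (by simp), mul_assoc, key]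
    simp
  · rw [if_neg (by simp), mul_assoc, key]
    simp [mul_assoc]

lemma tsum_int_affine {d : ℤ} (hd : d * d = 1) (k : ℤ) (f : ℝ → ℂ) :
    ∑' n : ℤ, f ((d * n + k : ℤ) : ℝ) = ∑' n : ℤ, f n := by
  have hinv : Function.Involutive fun m : ℤ ↦ d * m := fun m ↦ by
    linear_combination m * hd
  exact (hinv.toPerm.trans (Equiv.addRight k)).tsum_eq (fun n : ℤ ↦ f n)

/-- The Dirac comb is an eigenfunction of the shifted metaplectic operator, with
eigenvalue an eighth root of unity. -/
theorem stmt3 (a b c d q p : ℤ) (hdet : a * d - b * c = 1)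
    (hq : q ≡ a * b [ZMOD 2]) (hp : p ≡ c * d [ZMOD 2]) :
    ∃ μ : ℂ, μ ^ 8 = 1 ∧ ∀ f : SchwartzMap ℝ ℂ,
      shiftMetaPair (a : ℝ) (b : ℝ) (c : ℝ) (d : ℝ) (q : ℝ) (p : ℝ) (⇑f)
        = μ * ∑' n : ℤ, f (n : ℝ) := by
  by_cases hb : b = 0
  · subst hb
    have had : a * d = 1 := by linear_combination hdet
    obtain rfl : a = d := Int.eq_of_mul_eq_one had
    rw [mul_zero] at hq
    obtain ⟨k, hk⟩ := Int.modEq_zero_iff_dvd.1 hq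
    refine ⟨(if 0 < a then 1 else -Complex.I) * Complex.exp (Real.pi * Complex.I * (k * p / 2)),
      ?_, fun f ↦ ?_⟩
    · rw [mul_pow, ← Complex.exp_nat_mul]
      have h1 : ((if 0 < a then 1 else -Complex.I) : ℂ) ^ 8 = 1 := by
        split_ifs
        · simp
        · linear_combination (Complex.I ^ 4 + 1) * Complex.I_pow_four
      rw [h1, one_mul, ← Complex.exp_pi_mul_I_mul_even (even_two_mul (2 * k * p))]
      congr 1
      push_cast
      ring
    · rw [shiftMetaPair]
      simp only [Int.cast_zero, metaplectic_shift_of_eq_zero had hk hp]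
      rw [tsum_mul_left, tsum_int_affine had]
  · refine ⟨_, eigenvalue_pow_eight (p := p) hb hdet hq, fun f ↦ ?_⟩
    exact shiftMetaPair_of_ne_zero hb hdet hq hp f
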